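/- Let E : ℕ → ℝ be a nondecreasing sequence with E 0 = 0 and E i ≥ 0 satisfying the Gibbs condition, and let F_E be the associated maximal-entropy function. Let p and q be probability distributions on ℕ with ∑_i (E i)·(p i) ≤ t_p and ∑_i (E i)·(q i) ≤ t_q for some t_p, t_q > 0. Then for every ε ∈ (0,1] with TV(p,q) ≤ ε one has −( ε·F_E(t_q/ε) + g(ε) ) ≤ H(p) − H(q) ≤ ε·F_E(t_p/ε) + g(ε). -/

import Mathlib

open scoped ENNReal

/-- `p` is a probability distribution on `α`: nonnegative entries summing to `1`. -/
def IsProbDist {α : Type*} (p : α → ℝ) : Prop := (∀ x, 0 ≤ p x) ∧ HasSum p 1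

/-- Extended-real-valued Shannon entropy `H(r) = ∑ η(r i) ∈ [0,+∞]`,
where `η(x) = −x ln x`. -/
noncomputable def shEnt (r : ℕ → ℝ) : ℝ≥0∞ :=
  ∑' i, ENNReal.ofReal (Real.negMulLog (r i))

/-- Total variation distance `TV(p,q) = (1/2)·∑ |p x − q x|`. -/
noncomputable def TVd {α : Type*} (p q : α → ℝ) : ℝ := (1 / 2) * ∑' x, |p x - q x|

/-- `g(x) = (x+1)·ln(x+1) − x·ln x` (with `g(0) = 0`, as `Real.log 0 = 0`). -/
noncomputable def gFun (x : ℝ) : ℝ := (x + 1) * Real.log (x + 1) - x * Real.log x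

/-- Binary entropy `h₂(x) = η(x) + η(1−x)`. -/
noncomputable def h2 (x : ℝ) : ℝ := Real.negMulLog x + Real.negMulLog (1 - x)

/-- The Gibbs condition: `∑_i exp(−β·E i) < ∞` for every `β > 0`. -/
def GibbsCond (E : ℕ → ℝ) : Prop :=
  ∀ β : ℝ, 0 < β → Summable fun i => Real.exp (-β * E i)

/-- The mean energy `∑_i E i · p i ∈ [0,+∞]` (the terms being nonnegative for
probability distributions and nonnegative `E`). -/
noncomputable def meanE (E : ℕ → ℝ) (p : ℕ → ℝ) : ℝ≥0∞ :=
  ∑' i, ENNReal.ofReal (E i * p i)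

/-- The maximal-entropy function
`F_E(t) = sup{ H(p) : p prob. distribution on ℕ, ∑ E i · p i ≤ t }`. -/
noncomputable def FE (E : ℕ → ℝ) (t : ℝ) : ℝ :=
  sSup {h : ℝ | ∃ p : ℕ → ℝ, IsProbDist p ∧ meanE E p ≤ ENNReal.ofReal t ∧
    h = (shEnt p).toReal}

namespace Real

lemma negMulLog_add_le {x y : ℝ} (hx : 0 ≤ x) (hy : 0 ≤ y) :
    negMulLog (x + y) ≤ negMulLog x + negMulLog y := by
  have mul_log_le {u v : ℝ} (hu : 0 ≤ u) (huv : u ≤ v) : u * log u ≤ u * log v := by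
    rcases hu.eq_or_lt with rfl | hu
    · simp
    · exact mul_le_mul_of_nonneg_left (log_le_log hu huv) hu.le
  have h₁ := mul_log_le hx (le_add_of_nonneg_right hy)
  have h₂ := mul_log_le hy (le_add_of_nonneg_left hx)
  simp only [negMulLog]
  linarith

lemma negMulLog_le_mul_add_exp_neg {x : ℝ} (hx : 0 ≤ x) (e : ℝ) :
    negMulLog x ≤ e * x + exp (-e) := by
  rcases hx.eq_or_lt with rfl | hx
  · simpa using (exp_pos (-e)).le
  · have h := log_le_sub_one_of_pos (div_pos (exp_pos (-e)) hx)
    rw [log_div (exp_pos _).ne' hx.ne', log_exp] at h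
    have h' := mul_le_mul_of_nonneg_left h hx.le
    rw [mul_sub x (exp (-e) / x), mul_div_cancel₀ _ hx.ne'] at h'
    simp only [negMulLog]
    linarith

/-- If the masses `p + ε s` and `q + ε r` coincide, concavity and subadditivity of `negMulLog`
control the increment from `q` to `p`. -/
lemma negMulLog_le_of_add_mul_eq {ε p q r s : ℝ} (hε : 0 < ε) (hp : 0 ≤ p) (hq : 0 ≤ q)
    (hr : 0 ≤ r) (hs : 0 ≤ s) (hs1 : s ≤ 1) (h : p + ε * s = q + ε * r) :
    negMulLog p ≤
      negMulLog q + ε * negMulLog r + (log (1 + ε) * q + (ε * log (1 + ε) + negMulLog ε) * r) := by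
  have hε' : 0 < 1 + ε := by linarith
  have hconc := concaveOn_negMulLog.2 (Set.mem_Ici.2 hp) (Set.mem_Ici.2 hs)
    (inv_nonneg.2 hε'.le) (mul_nonneg hε.le (inv_nonneg.2 hε'.le)) (by field_simp)
  have hmix : (1 + ε)⁻¹ * p + ε * (1 + ε)⁻¹ * s = (1 + ε)⁻¹ * (q + ε * r) := by
    rw [← h]; ring
  simp only [smul_eq_mul] at hconc
  rw [hmix, negMulLog_mul] at hconc
  have hsub := negMulLog_add_le hq (mul_nonneg hε.le hr)
  rw [negMulLog_mul] at hsub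
  have hs0 := negMulLog_nonneg hs hs1
  have hinv : negMulLog (1 + ε)⁻¹ = (1 + ε)⁻¹ * log (1 + ε) := by
    simp [negMulLog, log_inv]
  rw [hinv] at hconc
  have hscaled := mul_le_mul_of_nonneg_left hconc hε'.le
  have hl : (1 + ε) * ((1 + ε)⁻¹ * negMulLog p + ε * (1 + ε)⁻¹ * negMulLog s) =
      negMulLog p + ε * negMulLog s := by field_simp
  have hr' : (1 + ε) * ((q + ε * r) * ((1 + ε)⁻¹ * log (1 + ε)) +
      (1 + ε)⁻¹ * negMulLog (q + ε * r)) =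
      (q + ε * r) * log (1 + ε) + negMulLog (q + ε * r) := by field_simp
  rw [hl, hr'] at hscaled
  nlinarith [mul_nonneg hε.le hs0]

end Real

lemma IsProbDist.le_one {α : Type*} {p : α → ℝ} (hp : IsProbDist p) (x : α) : p x ≤ 1 :=
  le_hasSum hp.2 x fun y _ => hp.1 y

lemma TVd_comm {α : Type*} (p q : α → ℝ) : TVd p q = TVd q p := by
  simp only [TVd, abs_sub_comm]

lemma shEnt_le_of_meanE_le {E p : ℕ → ℝ} (hE : ∀ i, 0 ≤ E i) (hG : GibbsCond E)
    (hp : IsProbDist p) {t : ℝ} (hpt : meanE E p ≤ ENNReal.ofReal t) :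
    shEnt p ≤ ENNReal.ofReal t + ENNReal.ofReal (∑' i, Real.exp (-E i)) := by
  have hsum : Summable fun i => Real.exp (-E i) := by simpa using hG 1 one_pos
  rw [ENNReal.ofReal_tsum_of_nonneg (fun i => (Real.exp_pos _).le) hsum]
  refine le_trans ?_ (add_le_add_left hpt _)
  rw [meanE, shEnt, ← ENNReal.tsum_add]
  refine ENNReal.tsum_le_tsum fun i => ?_
  rw [← ENNReal.ofReal_add (mul_nonneg (hE i) (hp.1 i)) (Real.exp_pos _).le]
  exact ENNReal.ofReal_le_ofReal (Real.negMulLog_le_mul_add_exp_neg (hp.1 i) _)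

lemma shEnt_ne_top {E p : ℕ → ℝ} (hE : ∀ i, 0 ≤ E i) (hG : GibbsCond E)
    (hp : IsProbDist p) {t : ℝ} (hpt : meanE E p ≤ ENNReal.ofReal t) : shEnt p ≠ ∞ :=
  ne_top_of_le_ne_top (by finiteness) (shEnt_le_of_meanE_le hE hG hp hpt)

lemma shEnt_toReal_le_FE {E p : ℕ → ℝ} (hE : ∀ i, 0 ≤ E i) (hG : GibbsCond E)
    (hp : IsProbDist p) {t : ℝ} (hpt : meanE E p ≤ ENNReal.ofReal t) :
    (shEnt p).toReal ≤ FE E t := by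
  refine le_csSup ⟨(ENNReal.ofReal t + ENNReal.ofReal (∑' i, Real.exp (-E i))).toReal, ?_⟩
    ⟨p, hp, hpt, rfl⟩
  rintro _ ⟨r, hr, hrt, rfl⟩
  exact ENNReal.toReal_mono (by finiteness) (shEnt_le_of_meanE_le hE hG hr hrt)

lemma IsProbDist.hasSum_negMulLog {p : ℕ → ℝ} (hp : IsProbDist p) (hH : shEnt p ≠ ∞) :
    HasSum (fun i => Real.negMulLog (p i)) (shEnt p).toReal := by
  have h := ENNReal.hasSum_toReal hH
  rw [← ENNReal.tsum_toReal_eq fun i => ENNReal.ofReal_ne_top] at h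
  simpa only [shEnt, ENNReal.toReal_ofReal (Real.negMulLog_nonneg (hp.1 _) (hp.le_one _))] using h

/-- The positive part of `p - q`, topped up at `0` to total mass `ε` and normalized. -/
noncomputable def excessDist (p q : ℕ → ℝ) (ε : ℝ) (i : ℕ) : ℝ :=
  (max (p i - q i) 0 + if i = 0 then ε - TVd p q else 0) / ε

lemma isProbDist_excessDist {p q : ℕ → ℝ} (hp : IsProbDist p) (hq : IsProbDist q) {ε : ℝ}
    (hε : 0 < ε) (hTV : TVd p q ≤ ε) : IsProbDist (excessDist p q ε) := by
  refine ⟨fun i => div_nonneg (add_nonneg (le_max_right _ _) ?_) hε.le, ?_⟩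
  · split_ifs
    · linarith
    · exact le_rfl
  have hd : HasSum (fun i => p i - q i) (1 - 1) := hp.2.sub hq.2
  have hmax : HasSum (fun i => max (p i - q i) 0) (TVd p q) := by
    have h := (hd.summable.abs.hasSum.add hd).mul_left (1 / 2)
    rw [sub_self, add_zero] at h
    refine (funext fun i => ?_ : (fun i => max (p i - q i) 0) = _) ▸ h
    rcases le_total (p i - q i) 0 with h | h
    · rw [max_eq_right h, abs_of_nonpos h]; ring
    · rw [max_eq_left h, abs_of_nonneg h]; ring
  have h := (hmax.add (hasSum_ite_eq 0 (ε - TVd p q))).div_const ε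
  rwa [add_sub_cancel, div_self hε.ne'] at h

lemma add_mul_excessDist_comm (p q : ℕ → ℝ) {ε : ℝ} (hε : ε ≠ 0) (i : ℕ) :
    p i + ε * excessDist q p ε i = q i + ε * excessDist p q ε i := by
  simp only [excessDist, TVd_comm q p, mul_div_cancel₀ _ hε]
  rcases le_total (p i) (q i) with h | h
  · rw [max_eq_left (sub_nonneg.2 h), max_eq_right (sub_nonpos.2 h)]; ring
  · rw [max_eq_right (sub_nonpos.2 h), max_eq_left (sub_nonneg.2 h)]; ring

lemma meanE_excessDist_le {E p q : ℕ → ℝ} (hE0 : E 0 = 0) (hE : ∀ i, 0 ≤ E i)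
    (hp : IsProbDist p) (hq : IsProbDist q) {ε t : ℝ} (hε : 0 < ε)
    (hpt : meanE E p ≤ ENNReal.ofReal t) :
    meanE E (excessDist p q ε) ≤ ENNReal.ofReal (t / ε) := by
  rw [ENNReal.ofReal_div_of_pos hε]
  refine le_trans ?_ (ENNReal.div_le_div_right hpt _)
  rw [meanE, meanE, div_eq_mul_inv, ← ENNReal.tsum_mul_right]
  refine ENNReal.tsum_le_tsum fun i => ?_
  rw [← div_eq_mul_inv, ← ENNReal.ofReal_div_of_pos hε, mul_div_assoc]
  refine ENNReal.ofReal_le_ofReal ?_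
  rcases eq_or_ne i 0 with rfl | hi
  · simp [hE0]
  · simp only [excessDist, if_neg hi, add_zero]
    have hmax : max (p i - q i) 0 ≤ p i := max_le (by linarith [hq.1 i]) (hp.1 i)
    have := hE i
    gcongr

lemma shEnt_toReal_sub_le {E p q : ℕ → ℝ} (hE0 : E 0 = 0) (hE : ∀ i, 0 ≤ E i)
    (hG : GibbsCond E) (hp : IsProbDist p) (hq : IsProbDist q) {ε tp tq : ℝ}
    (hpt : meanE E p ≤ ENNReal.ofReal tp) (hqt : meanE E q ≤ ENNReal.ofReal tq)
    (hε : 0 < ε) (hTV : TVd p q ≤ ε) :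
    (shEnt p).toReal - (shEnt q).toReal ≤ ε * FE E (tp / ε) + gFun ε := by
  have hr := isProbDist_excessDist hp hq hε hTV
  have hs := isProbDist_excessDist hq hp hε (TVd_comm p q ▸ hTV)
  have hrt := meanE_excessDist_le hE0 hE hp hq hε hpt
  have hle := hasSum_le (fun i => Real.negMulLog_le_of_add_mul_eq hε (hp.1 i) (hq.1 i) (hr.1 i)
      (hs.1 i) (hs.le_one i) (add_mul_excessDist_comm p q hε.ne' i))
    (hp.hasSum_negMulLog (shEnt_ne_top hE hG hp hpt))
    (((hq.hasSum_negMulLog (shEnt_ne_top hE hG hq hqt)).add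
      ((hr.hasSum_negMulLog (shEnt_ne_top hE hG hr hrt)).mul_left ε)).add
      ((hq.2.mul_left _).add (hr.2.mul_left _)))
  have hF := mul_le_mul_of_nonneg_left (shEnt_toReal_le_FE hE hG hr hrt) hε.le
  have hg : gFun ε = Real.log (1 + ε) + (ε * Real.log (1 + ε) + Real.negMulLog ε) := by
    rw [gFun, Real.negMulLog, add_comm ε 1]; ring
  linarith

/-- **Two-sided continuity bound for the Shannon entropy of distributions with
different energy bounds**: if `∑ E i · p i ≤ t_p` and `∑ E i · q i ≤ t_q`, then
for `TV(p,q) ≤ ε ≤ 1`,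
`−(ε·F_E(t_q/ε) + g(ε)) ≤ H(p) − H(q) ≤ ε·F_E(t_p/ε) + g(ε)`. -/
theorem entropy_energy_two_side_bound
    (E : ℕ → ℝ) (hmono : Monotone E) (hE0 : E 0 = 0) (hEnn : ∀ i, 0 ≤ E i)
    (hGibbs : GibbsCond E) (tp tq : ℝ) (htp : 0 < tp) (htq : 0 < tq)
    (p : ℕ → ℝ) (hp : IsProbDist p) (hpt : meanE E p ≤ ENNReal.ofReal tp)
    (q : ℕ → ℝ) (hq : IsProbDist q) (hqt : meanE E q ≤ ENNReal.ofReal tq)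
    (ε : ℝ) (hε0 : 0 < ε) (hε1 : ε ≤ 1) (hTV : TVd p q ≤ ε) :
    ((-(ε * FE E (tq / ε) + gFun ε) : ℝ) : EReal) ≤
        (shEnt p : EReal) - (shEnt q : EReal) ∧
    (shEnt p : EReal) - (shEnt q : EReal) ≤
        ((ε * FE E (tp / ε) + gFun ε : ℝ) : EReal) := by
  have hp' := shEnt_ne_top hEnn hGibbs hp hpt
  have hq' := shEnt_ne_top hEnn hGibbs hq hqt
  rw [← EReal.coe_toReal (x := (shEnt p : EReal)) (by simpa using hp') (by simp),
    ← EReal.coe_toReal (x := (shEnt q : EReal)) (by simpa using hq') (by simp), ← EReal.coe_sub,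
    EReal.coe_le_coe_iff, EReal.coe_le_coe_iff, EReal.toReal_coe_ennreal,
    EReal.toReal_coe_ennreal, neg_le, neg_sub]
  exact ⟨shEnt_toReal_sub_le hE0 hEnn hGibbs hq hp hqt hpt hε0 (TVd_comm p q ▸ hTV),
    shEnt_toReal_sub_le hE0 hEnn hGibbs hp hq hpt hqt hε0 hTV⟩
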